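/- Let Ψ: [0,∞) → ℝ be twice continuously differentiable and suppose that the mapping F ↦ Ψ(‖dev₃ log U‖²) is rank-one convex on GL⁺(3), where U = √(FᵀF). Then: (i) Ψ is convex on [0,∞); and (ii) if Ψ'(0) > 0, then Ψ'(x) > 0 for all x > 0. -/

import Mathlib

open Matrix Real

attribute [local instance] Matrix.frobeniusNormedAddCommGroup Matrix.frobeniusNormedSpace

noncomputable section

/-- The space of real `n × n` matrices. -/
abbrev Mat (n : ℕ) := Matrix (Fin n) (Fin n) ℝ

/-- `GL⁺(n)`: real `n × n` matrices with positive determinant. -/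
def GLp (n : ℕ) : Set (Mat n) := {F | 0 < F.det}

/-- Frobenius inner product `⟨X, Y⟩ = tr (X Yᵀ)`. -/
def inn {n : ℕ} (X Y : Mat n) : ℝ := (X * Yᵀ).trace

/-- Squared Frobenius norm `‖X‖² = tr (Xᵀ X)`. -/
def nsq {n : ℕ} (X : Mat n) : ℝ := (Xᵀ * X).trace

/-- The primary matrix function associated to `f : ℝ → ℝ`: applies `f` to the eigenvalues
in a spectral decomposition of a Hermitian (i.e. real symmetric) matrix, junk value `0`
otherwise. -/
def matFun {n : ℕ} (f : ℝ → ℝ) (A : Mat n) : Mat n :=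
  if hA : A.IsHermitian then
    (hA.eigenvectorUnitary : Mat n) * Matrix.diagonal (f ∘ hA.eigenvalues) *
      (star (hA.eigenvectorUnitary : Mat n))
  else 0

/-- Principal square root of a symmetric positive semidefinite matrix. -/
def matSqrt {n : ℕ} (A : Mat n) : Mat n := matFun Real.sqrt A

/-- Principal matrix logarithm of a symmetric positive definite matrix. -/
def matLog {n : ℕ} (A : Mat n) : Mat n := matFun Real.log A

/-- `log U` where `U = √(FᵀF)` is the right stretch tensor of `F`. -/
def logU {n : ℕ} (F : Mat n) : Mat n := matLog (matSqrt (Fᵀ * F))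

/-- `log V` where `V = √(FFᵀ)` is the left stretch tensor of `F`. -/
def logV {n : ℕ} (F : Mat n) : Mat n := matLog (matSqrt (F * Fᵀ))

/-- Deviatoric (trace-free) part `dev_n X = X - (tr X / n) 𝟙`. -/
def dev {n : ℕ} (X : Mat n) : Mat n := X - (X.trace / n) • (1 : Mat n)

/-- Rank-one convexity of `W : GL⁺(n) → ℝ`: along every rank-one line segment contained in
`GL⁺(n)`, the function is convex. -/
def RankOneConvex {n : ℕ} (W : Mat n → ℝ) : Prop :=
  ∀ F ∈ GLp n, ∀ ξ η : Fin n → ℝ, ∀ I : Set ℝ, Convex ℝ I →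
    (∀ t ∈ I, 0 < (F + t • vecMulVec ξ η).det) →
    ConvexOn ℝ I (fun t => W (F + t • vecMulVec ξ η))

end

theorem matFun_eq_of_eq_conj {n : ℕ} (f : ℝ → ℝ) {A U : Mat n} {d : Fin n → ℝ}
    (hU : U ∈ unitary (Mat n)) (hA : A = U * diagonal d * star U) :
    matFun f A = U * diagonal (f ∘ d) * star U := by
  have hH : A.IsHermitian := by
    rw [hA, star_eq_conjTranspose]
    exact isHermitian_mul_mul_conjTranspose U (isHermitian_diagonal d)
  have hspec : A = (hH.eigenvectorUnitary : Mat n) * diagonal hH.eigenvalues *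
      star (hH.eigenvectorUnitary : Mat n) := by
    simpa [Unitary.conjStarAlgAut_apply, Function.comp_def] using hH.spectral_theorem
  rw [matFun, dif_pos hH]
  set V : Mat n := (hH.eigenvectorUnitary : Mat n)
  set e := hH.eigenvalues
  have hV1 : star V * V = 1 := (Unitary.mem_iff.1 hH.eigenvectorUnitary.2).1
  have hV2 : V * star V = 1 := (Unitary.mem_iff.1 hH.eigenvectorUnitary.2).2
  obtain ⟨hU1, hU2⟩ := Unitary.mem_iff.1 hU
  have key : diagonal d * (star U * V) = (star U * V) * diagonal e := by
    calc diagonal d * (star U * V) = (star U * U) * diagonal d * star U * V := by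
          rw [hU1]; noncomm_ring
      _ = star U * A * V := by rw [hA]; noncomm_ring
      _ = star U * V * diagonal e * (star V * V) := by
          conv_lhs => rw [hspec]
          noncomm_ring
      _ = _ := by rw [hV1, mul_one]
  have key2 : diagonal (f ∘ d) * (star U * V) = (star U * V) * diagonal (f ∘ e) := by
    ext i j
    have h := congrFun (congrFun key i) j
    rw [diagonal_mul, mul_diagonal] at h ⊢
    by_cases hw : (star U * V) i j = 0
    · simp [hw]
    · have : d i = e j := mul_right_cancel₀ hw (by rw [h, mul_comm])
      simp [this, mul_comm]
  calc V * diagonal (f ∘ e) * star V = (U * star U) * V * diagonal (f ∘ e) * star V := by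
        rw [hU2, one_mul]
    _ = U * (star U * V * diagonal (f ∘ e)) * star V := by noncomm_ring
    _ = U * diagonal (f ∘ d) * star U * (V * star V) := by rw [← key2]; noncomm_ring
    _ = _ := by rw [hV2, mul_one]

theorem logU_eq_of_eq_conj {n : ℕ} {F U : Mat n} {d : Fin n → ℝ}
    (hU : U ∈ unitary (Mat n)) (hF : Fᵀ * F = U * diagonal d * star U) :
    logU F = U * diagonal (fun i => Real.log (√(d i))) * star U :=
  matFun_eq_of_eq_conj _ hU (matFun_eq_of_eq_conj _ hU hF)

theorem nsq_dev_conj_diagonal {U : Mat 3} (hU : U ∈ unitary (Mat 3)) (x : Fin 3 → ℝ) :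
    nsq (dev (U * diagonal x * star U)) = ∑ i, x i ^ 2 - (∑ i, x i) ^ 2 / 3 := by
  obtain ⟨hU1, hU2⟩ := Unitary.mem_iff.1 hU
  have htr (Y : Mat 3) : (U * Y * star U).trace = Y.trace := by
    rw [trace_mul_comm, ← mul_assoc, hU1, one_mul]
  have hdev : dev (U * diagonal x * star U) = U * dev (diagonal x) * star U := by
    simp only [dev, htr, mul_sub, sub_mul, mul_smul_comm, smul_mul_assoc, mul_one, hU2]
  have hT : Uᵀ = star U := by rw [star_eq_conjTranspose, conjTranspose_eq_transpose_of_trivial]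
  have hT' : (star U)ᵀ = U := by rw [← hT, transpose_transpose]
  have hns : nsq (U * dev (diagonal x) * star U) = nsq (dev (diagonal x)) := by
    rw [nsq, nsq, transpose_mul, transpose_mul, hT, hT', ← htr ((dev (diagonal x))ᵀ * _)]
    congr 1
    calc _ = U * ((dev (diagonal x))ᵀ) * (star U * U) * dev (diagonal x) * star U := by
          noncomm_ring
      _ = _ := by rw [hU1]; noncomm_ring
  rw [hdev, hns]
  simp [nsq, dev, Matrix.trace, Fin.sum_univ_three, Matrix.mul_apply, Matrix.one_apply]
  ring

theorem nsq_dev_logU_diagonal {d : Fin 3 → ℝ} (hd : ∀ i, 0 < d i) :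
    nsq (dev (logU (diagonal d))) =
      ∑ i, Real.log (d i) ^ 2 - (∑ i, Real.log (d i)) ^ 2 / 3 := by
  have h1 : (1 : Mat 3) ∈ unitary (Mat 3) := one_mem _
  rw [logU_eq_of_eq_conj (d := fun i => d i ^ 2) h1 (by simp [sq]),
    nsq_dev_conj_diagonal h1]
  simp only [Real.sqrt_sq (hd _).le]

theorem sum_sq_le_of_le_of_neg_le {a b c u w : ℝ} (h : a + b + c = 0)
    (ha : a ≤ u) (hb : b ≤ u) (hc : c ≤ u) (ha' : -a ≤ w) (hb' : -b ≤ w) (hc' : -c ≤ w) :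
    a ^ 2 + b ^ 2 + c ^ 2 ≤ u ^ 2 + w ^ 2 + (u - w) ^ 2 := by
  have key {x y z : ℝ} (h : x + y + z = 0) (hxy : y ≤ x) (hyz : z ≤ y)
      (hx : x ≤ u) (hz : -z ≤ w) :
      x ^ 2 + y ^ 2 + z ^ 2 ≤ u ^ 2 + w ^ 2 + (u - w) ^ 2 := by
    obtain rfl : y = -x - z := by linarith
    nlinarith [mul_nonneg (sub_nonneg.2 hx) (sub_nonneg.2 hxy),
      mul_nonneg (sub_nonneg.2 hz) (sub_nonneg.2 hyz), sq_nonneg (u - x), sq_nonneg (w + z),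
      sq_nonneg (u - x - (w + z))]
  rcases le_total a b with h1 | h1 <;> rcases le_total b c with h2 | h2 <;>
    rcases le_total a c with h3 | h3
  · linarith [key (x := c) (y := b) (z := a) (by linarith) h2 h1 hc ha']
  · linarith [key (x := c) (y := b) (z := a) (by linarith) h2 h1 hc ha']
  · linarith [key (x := b) (y := c) (z := a) (by linarith) h2 h3 hb ha']
  · linarith [key (x := b) (y := a) (z := c) (by linarith) h1 h3 hb hc']
  · linarith [key (x := c) (y := a) (z := b) (by linarith) h3 h1 hc hb']
  · linarith [key (x := a) (y := c) (z := b) (by linarith) h3 h2 ha hb']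
  · linarith [key (x := a) (y := b) (z := c) (by linarith) h1 h2 ha hc']
  · linarith [key (x := a) (y := b) (z := c) (by linarith) h1 h2 ha hc']

theorem exists_conj_diagonal_of_mul_eq_one {F G : Mat 3} (hFG : F * G = 1) :
    ∃ U ∈ unitary (Mat 3), ∃ e : Fin 3 → ℝ, Fᵀ * F = U * diagonal e * star U ∧
      ∏ i, e i = F.det ^ 2 ∧ ∀ i, 0 < e i ∧ e i ≤ nsq F ∧ (e i)⁻¹ ≤ nsq G := by
  have hGF : G * F = 1 := mul_eq_one_comm.1 hFG
  have hinj : Function.Injective F.mulVec := by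
    intro v v' h
    simpa [mulVec_mulVec, hGF] using congrArg G.mulVec h
  have hP : (Fᵀ * F).PosDef := by
    rw [← conjTranspose_eq_transpose_of_trivial]
    exact PosDef.conjTranspose_mul_self F hinj
  have hH := hP.isHermitian
  have hpos (i) : 0 < hH.eigenvalues i := hP.eigenvalues_pos i
  have hspec : Fᵀ * F = (hH.eigenvectorUnitary : Mat 3) * diagonal hH.eigenvalues *
      star (hH.eigenvectorUnitary : Mat 3) := by
    simpa [Unitary.conjStarAlgAut_apply, Function.comp_def] using hH.spectral_theorem
  have hdet : (Fᵀ * F).det = ∏ i, hH.eigenvalues i := by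
    simpa using hH.det_eq_prod_eigenvalues
  have htr : (Fᵀ * F).trace = ∑ i, hH.eigenvalues i := by
    simpa using hH.trace_eq_sum_eigenvalues
  refine ⟨hH.eigenvectorUnitary, hH.eigenvectorUnitary.2, hH.eigenvalues, hspec, ?_, ?_⟩
  · rw [← hdet, det_mul, det_transpose, sq]
  intro i
  refine ⟨hpos i, ?_, ?_⟩
  · rw [nsq, htr]
    exact Finset.single_le_sum (fun j _ => (hpos j).le) (Finset.mem_univ i)
  set V : Mat 3 := (hH.eigenvectorUnitary : Mat 3)
  set e := hH.eigenvalues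
  have hV1 : star V * V = 1 := (Unitary.mem_iff.1 hH.eigenvectorUnitary.2).1
  have hV2 : V * star V = 1 := (Unitary.mem_iff.1 hH.eigenvectorUnitary.2).2
  have hC : (Fᵀ * F) * (G * Gᵀ) = 1 := by
    calc (Fᵀ * F) * (G * Gᵀ) = Fᵀ * (F * G) * Gᵀ := by noncomm_ring
      _ = (G * F)ᵀ := by rw [hFG, mul_one, transpose_mul]
      _ = 1 := by rw [hGF, transpose_one]
  have hD : diagonal e * (star V * (G * Gᵀ) * V) = 1 := by
    calc diagonal e * (star V * (G * Gᵀ) * V)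
        = (star V * V) * diagonal e * star V * (G * Gᵀ) * V := by rw [hV1]; noncomm_ring
      _ = star V * ((V * diagonal e * star V) * (G * Gᵀ)) * V := by noncomm_ring
      _ = 1 := by rw [← hspec, hC, mul_one, hV1]
  have hdiag (j) : (star V * (G * Gᵀ) * V) j j = (e j)⁻¹ := by
    have h := congrFun (congrFun hD j) j
    rw [diagonal_mul, one_apply_eq] at h
    exact eq_inv_of_mul_eq_one_right h
  have htrG : nsq G = ∑ j, (e j)⁻¹ := by
    calc nsq G = (star V * (G * Gᵀ) * V).trace := by
          rw [trace_mul_comm, ← mul_assoc, hV2, one_mul, nsq, trace_mul_comm]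
      _ = _ := by simp only [Matrix.trace, diag_apply, hdiag]
  rw [htrG]
  exact Finset.single_le_sum (f := fun j => (e j)⁻¹) (fun j _ => (inv_pos.2 (hpos j)).le)
    (Finset.mem_univ i)

theorem nsq_dev_logU_le {F G : Mat 3} {u w : ℝ} (hFG : F * G = 1) (hdet : F.det = 1)
    (hF : nsq F ≤ Real.exp (2 * u)) (hG : nsq G ≤ Real.exp (2 * w)) :
    nsq (dev (logU F)) ≤ u ^ 2 + w ^ 2 + (u - w) ^ 2 := by
  obtain ⟨U, hU, e, hC, hprod, he⟩ := exists_conj_diagonal_of_mul_eq_one hFG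
  rw [logU_eq_of_eq_conj hU hC, nsq_dev_conj_diagonal hU]
  have hlog (i) : Real.log (√(e i)) = Real.log (e i) / 2 := Real.log_sqrt (he i).1.le
  have hu (i) : Real.log (e i) / 2 ≤ u := by
    have := (Real.log_le_iff_le_exp (he i).1).2 ((he i).2.1.trans hF)
    linarith
  have hw (i) : -(Real.log (e i) / 2) ≤ w := by
    have := (Real.log_le_iff_le_exp (inv_pos.2 (he i).1)).2 ((he i).2.2.trans hG)
    rw [Real.log_inv] at this
    linarith
  have hsum : ∑ i, Real.log (e i) = 0 := by
    rw [← Real.log_prod (fun i _ => (he i).1.ne'), hprod, hdet]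
    simp
  simp only [hlog]
  rw [Fin.sum_univ_three] at hsum
  rw [Fin.sum_univ_three, Fin.sum_univ_three]
  have h0 : Real.log (e 0) / 2 + Real.log (e 1) / 2 + Real.log (e 2) / 2 = 0 := by linarith
  have := sum_sq_le_of_le_of_neg_le h0 (hu 0) (hu 1) (hu 2) (hw 0) (hw 1) (hw 2)
  rw [h0]
  linarith

/-- A rank-one line of unimodular matrices through `diag (B², 1, B⁻²)`, which is tangent there
to the level set of `F ↦ nsq (dev (logU F))`. -/
noncomputable def tangentLine (B t : ℝ) : Mat 3 :=
  diagonal ![B ^ 2, 1, (B ^ 2)⁻¹] + t • vecMulVec ![B, 1, B⁻¹] ![B, -2, B⁻¹]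

theorem tangentLine_eq (B t : ℝ) :
    tangentLine B t = !![B ^ 2 + t * (B * B), t * (B * -2), t * (B * B⁻¹);
      t * B, 1 + t * -2, t * B⁻¹;
      t * (B⁻¹ * B), t * (B⁻¹ * -2), (B ^ 2)⁻¹ + t * (B⁻¹ * B⁻¹)] := by
  ext i j
  fin_cases i <;> fin_cases j <;> simp [tangentLine]

theorem det_tangentLine {B : ℝ} (hB : B ≠ 0) (t : ℝ) : (tangentLine B t).det = 1 := by
  rw [tangentLine_eq, det_fin_three]
  simp
  field_simp
  ring

theorem nsq_tangentLine {B : ℝ} (hB : B ≠ 0) (t : ℝ) :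
    nsq (tangentLine B t) = B ^ 4 + 1 + (B ^ 4)⁻¹ + 2 * t * (B ^ 4 - 2 + (B ^ 4)⁻¹) +
      t ^ 2 * ((B ^ 2 + 1 + (B ^ 2)⁻¹) * (B ^ 2 + 4 + (B ^ 2)⁻¹)) := by
  rw [tangentLine_eq, nsq]
  simp [Matrix.trace, Fin.sum_univ_three, Matrix.mul_apply]
  field_simp
  ring

theorem tangentLine_mul_submatrix {B : ℝ} (hB : B ≠ 0) (t : ℝ) :
    tangentLine B t * (tangentLine B (-t)).submatrix (Equiv.swap 0 2) (Equiv.swap 0 2) = 1 := by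
  have h1 : Equiv.swap (0 : Fin 3) 2 1 = 1 := by decide
  rw [tangentLine_eq, tangentLine_eq]
  ext i j
  fin_cases i <;> fin_cases j <;> simp [Matrix.mul_apply, Fin.sum_univ_three, h1] <;>
    field_simp <;> ring

theorem nsq_submatrix {n : ℕ} (X : Mat n) (σ : Equiv.Perm (Fin n)) :
    nsq (X.submatrix σ σ) = nsq X := by
  rw [nsq, transpose_submatrix, submatrix_mul_equiv, nsq]
  exact Equiv.sum_comp σ fun i => (Xᵀ * X) i i

theorem nsq_dev_logU_tangentLine_le {B t u w : ℝ} (hB : B ≠ 0)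
    (hu : nsq (tangentLine B t) ≤ Real.exp (2 * u))
    (hw : nsq (tangentLine B (-t)) ≤ Real.exp (2 * w)) :
    nsq (dev (logU (tangentLine B t))) ≤ u ^ 2 + w ^ 2 + (u - w) ^ 2 :=
  nsq_dev_logU_le (tangentLine_mul_submatrix hB t) (det_tangentLine hB t) hu
    (by rwa [nsq_submatrix])

theorem nsq_dev_logU_tangentLine_zero {B : ℝ} (hB : 0 < B) :
    nsq (dev (logU (tangentLine B 0))) = 8 * Real.log B ^ 2 := by
  rw [tangentLine, zero_smul, add_zero, nsq_dev_logU_diagonal]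
  · simp [Fin.sum_univ_three]
    ring
  · intro i
    fin_cases i <;> simp <;> positivity

theorem nsq_tangentLine_pos_le {B : ℝ} (hB : 32 ≤ B) :
    nsq (tangentLine B (3 / 4)) ≤ Real.exp (2 * (2 * Real.log B + Real.log 2)) := by
  have h0 : 0 < B := by linarith
  have hexp : Real.exp (2 * (2 * Real.log B + Real.log 2)) = 4 * B ^ 4 := by
    rw [show 2 * (2 * Real.log B + Real.log 2) = Real.log (4 * B ^ 4) by
      rw [Real.log_mul (by norm_num) (by positivity), Real.log_pow,
        show (4 : ℝ) = 2 ^ 2 by norm_num, Real.log_pow]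
      push_cast; ring]
    exact Real.exp_log (by positivity)
  rw [hexp, nsq_tangentLine h0.ne']
  have hi : (B ^ 2)⁻¹ ≤ 1 := inv_le_one_of_one_le₀ (by nlinarith)
  have hi' : 0 < (B ^ 2)⁻¹ := by positivity
  have h4 : (B ^ 4)⁻¹ = (B ^ 2)⁻¹ ^ 2 := by rw [← inv_pow]; ring
  have h4' : B ^ 4 = (B ^ 2) ^ 2 := by ring
  have hA : 1024 ≤ B ^ 2 := by nlinarith
  have hm : B ^ 2 * (B ^ 2)⁻¹ = 1 := mul_inv_cancel₀ (by positivity)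
  rw [h4, h4']
  generalize B ^ 2 = A at *
  generalize A⁻¹ = a at *
  nlinarith

theorem nsq_tangentLine_neg_le {B : ℝ} (hB : 32 ≤ B) :
    nsq (tangentLine B (-(3 / 4))) ≤
      Real.exp (2 * (2 * Real.log B - 3 / 2 * Real.log 2)) := by
  have h0 : 0 < B := by linarith
  have hexp : Real.exp (2 * (2 * Real.log B - 3 / 2 * Real.log 2)) = B ^ 4 / 8 := by
    rw [show 2 * (2 * Real.log B - 3 / 2 * Real.log 2) = Real.log (B ^ 4 / 8) by
      rw [Real.log_div (by positivity) (by norm_num), Real.log_pow,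
        show (8 : ℝ) = 2 ^ 3 by norm_num, Real.log_pow]
      push_cast; ring]
    exact Real.exp_log (by positivity)
  rw [hexp, nsq_tangentLine h0.ne']
  have hi : (B ^ 2)⁻¹ ≤ 1 := inv_le_one_of_one_le₀ (by nlinarith)
  have hi' : 0 < (B ^ 2)⁻¹ := by positivity
  have h4 : (B ^ 4)⁻¹ = (B ^ 2)⁻¹ ^ 2 := by rw [← inv_pow]; ring
  have h4' : B ^ 4 = (B ^ 2) ^ 2 := by ring
  have hA : 1024 ≤ B ^ 2 := by nlinarith
  have hm : B ^ 2 * (B ^ 2)⁻¹ = 1 := mul_inv_cancel₀ (by positivity)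
  rw [h4, h4']
  generalize B ^ 2 = A at *
  generalize A⁻¹ = a at *
  nlinarith

theorem le_max_of_rankOneConvex {n : ℕ} {W : Mat n → ℝ} (hW : RankOneConvex W) {F : Mat n}
    {ξ η : Fin n → ℝ} (hdet : ∀ t : ℝ, 0 < (F + t • vecMulVec ξ η).det) {a b c : ℝ}
    (hc : c ∈ Set.Icc a b) :
    W (F + c • vecMulVec ξ η) ≤ max (W (F + a • vecMulVec ξ η)) (W (F + b • vecMulVec ξ η)) :=
  (hW F (by simpa [GLp] using hdet 0) ξ η Set.univ convex_univ fun t _ => hdet t).le_max_of_mem_Icc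
    (Set.mem_univ a) (Set.mem_univ b) hc

theorem convexOn_comp_log_sq_of_rankOneConvex {Ψ : ℝ → ℝ}
    (hW : RankOneConvex (fun F : Mat 3 => Ψ (nsq (dev (logU F))))) :
    ConvexOn ℝ (Set.Ioi (0 : ℝ)) fun s => Ψ (2 / 3 * Real.log s ^ 2) := by
  have hmat (t : ℝ) : (1 : Mat 3) + t • vecMulVec ![1, 0, 0] ![1, 0, 0] =
      diagonal ![t + 1, 1, 1] := by
    ext i j
    fin_cases i <;> fin_cases j <;> simp [add_comm]
  have h := hW 1 (by simp [GLp]) ![1, 0, 0] ![1, 0, 0] (Set.Ioi (-1)) (convex_Ioi _) (by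
    intro t ht
    rw [hmat, det_diagonal, Fin.prod_univ_three]
    simp only [Set.mem_Ioi] at ht
    simpa using by linarith)
  have h' := h.translate_left (-1)
  refine (h'.subset ?_ (convex_Ioi 0)).congr ?_
  · intro s hs
    simp only [Set.mem_Ioi] at hs
    simpa using hs
  · intro s hs
    simp only [Set.mem_Ioi] at hs
    simp only [Function.comp_apply, hmat]
    rw [nsq_dev_logU_diagonal]
    · simp [Fin.sum_univ_three]
      ring_nf
    · intro i
      fin_cases i <;> simp [hs]

theorem two_thirds_mul_log_exp_sqrt_sq {x : ℝ} (hx : 0 ≤ x) :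
    2 / 3 * Real.log (Real.exp (√(3 / 2 * x))) ^ 2 = x := by
  rw [Real.log_exp, Real.sq_sqrt (by positivity)]
  ring

theorem monotoneOn_of_rankOneConvex {Ψ : ℝ → ℝ}
    (hW : RankOneConvex (fun F : Mat 3 => Ψ (nsq (dev (logU F))))) :
    MonotoneOn Ψ (Set.Ici 0) := by
  intro x hx y hy hxy
  simp only [Set.mem_Ici] at hx hy
  have h := (convexOn_comp_log_sq_of_rankOneConvex hW).le_max_of_mem_Icc
    (x := (Real.exp (√(3 / 2 * y)))⁻¹) (y := Real.exp (√(3 / 2 * y)))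
    (z := Real.exp (√(3 / 2 * x))) (by simp [Real.exp_pos]) (by simp [Real.exp_pos])
    ⟨by
      rw [← Real.exp_neg, Real.exp_le_exp]
      linarith [Real.sqrt_nonneg (3 / 2 * x), Real.sqrt_nonneg (3 / 2 * y)], by
      rw [Real.exp_le_exp]
      exact Real.sqrt_le_sqrt (by linarith)⟩
  simpa only [Real.log_inv, neg_sq, two_thirds_mul_log_exp_sqrt_sq hx,
    two_thirds_mul_log_exp_sqrt_sq hy, max_self] using h

theorem apply_le_apply_zero_of_rankOneConvex {Ψ : ℝ → ℝ}
    (hW : RankOneConvex (fun F : Mat 3 => Ψ (nsq (dev (logU F))))) {x y : ℝ}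
    (hx : 0 ≤ x) (hxy : x < y) (h : Ψ y ≤ Ψ x) : Ψ y ≤ Ψ 0 := by
  rcases hx.eq_or_lt with rfl | hx
  · exact h
  have hy := hx.trans hxy
  have h1 : (1 : ℝ) < Real.exp (√(3 / 2 * x)) := Real.one_lt_exp_iff.2 (by positivity)
  have h2 : Real.exp (√(3 / 2 * x)) < Real.exp (√(3 / 2 * y)) :=
    Real.exp_lt_exp.2 (Real.sqrt_lt_sqrt (by positivity) (by linarith))
  have hs := (convexOn_comp_log_sq_of_rankOneConvex hW).slope_mono_adjacent
    (Set.mem_Ioi.2 one_pos) (Set.mem_Ioi.2 (Real.exp_pos (√(3 / 2 * y)))) h1 h2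
  simp only [two_thirds_mul_log_exp_sqrt_sq hx.le, two_thirds_mul_log_exp_sqrt_sq hy.le,
    Real.log_one, zero_pow two_ne_zero, mul_zero] at hs
  have h3 := hs.trans (div_nonpos_of_nonpos_of_nonneg (sub_nonpos.2 h) (sub_pos.2 h2).le)
  have h4 := (div_le_iff₀ (sub_pos.2 h1)).1 h3
  linarith

/-- Rank-one convexity of `F ↦ Ψ (‖dev₃ log U‖²)` forces `Ψ` to be constant on `[0, ∞)`. -/
theorem apply_eq_apply_zero_of_rankOneConvex {Ψ : ℝ → ℝ}
    (hW : RankOneConvex (fun F : Mat 3 => Ψ (nsq (dev (logU F))))) {x : ℝ} (hx : 0 ≤ x) :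
    Ψ x = Ψ 0 := by
  have hmono := monotoneOn_of_rankOneConvex hW
  have hl : 0 < Real.log 2 := Real.log_pos one_lt_two
  obtain ⟨B, hB, hxB⟩ : ∃ B : ℝ, 32 ≤ B ∧ x ≤ 8 * Real.log B ^ 2 := by
    refine ⟨max 32 (Real.exp (x + 1)), le_max_left _ _, ?_⟩
    have : x + 1 ≤ Real.log (max 32 (Real.exp (x + 1))) :=
      (Real.le_log_iff_exp_le (by positivity)).2 (le_max_right _ _)
    nlinarith
  have hB0 : 0 < B := by linarith
  have hLB : 5 * Real.log 2 ≤ Real.log B := by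
    rw [show 5 * Real.log 2 = Real.log 32 by
      rw [show (32 : ℝ) = 2 ^ 5 by norm_num, Real.log_pow]; norm_num]
    exact Real.log_le_log (by norm_num) hB
  have hpos := nsq_tangentLine_pos_le hB
  have hneg := nsq_tangentLine_neg_le hB
  have hup := nsq_dev_logU_tangentLine_le hB0.ne' hpos hneg
  have hdown := nsq_dev_logU_tangentLine_le hB0.ne' hneg (by rwa [neg_neg])
  have hmax := le_max_of_rankOneConvex hW (F := diagonal ![B ^ 2, 1, (B ^ 2)⁻¹])
    (ξ := ![B, 1, B⁻¹]) (η := ![B, -2, B⁻¹])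
    (fun t => (det_tangentLine hB0.ne' t).symm ▸ one_pos)
    (a := -(3 / 4)) (b := 3 / 4) (c := 0) (by constructor <;> norm_num)
  have hline (t : ℝ) : diagonal ![B ^ 2, 1, (B ^ 2)⁻¹] +
      t • vecMulVec ![B, 1, B⁻¹] ![B, -2, B⁻¹] = tangentLine B t := rfl
  simp only [hline, nsq_dev_logU_tangentLine_zero hB0] at hmax
  have hnn (X : Mat 3) : 0 ≤ nsq X := by
    simp only [nsq, Matrix.trace, diag_apply, Matrix.mul_apply, transpose_apply]
    exact Finset.sum_nonneg fun i _ => Finset.sum_nonneg fun j _ => mul_self_nonneg _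
  set q := (2 * Real.log B + Real.log 2) ^ 2 + (2 * Real.log B - 3 / 2 * Real.log 2) ^ 2 +
    (2 * Real.log B + Real.log 2 - (2 * Real.log B - 3 / 2 * Real.log 2)) ^ 2 with hq
  have hq0 : 0 ≤ q := by positivity
  have hqlt : q < 8 * Real.log B ^ 2 := by
    rw [hq]
    nlinarith
  have hle : Ψ (8 * Real.log B ^ 2) ≤ Ψ q :=
    hmax.trans (max_le (hmono (hnn _) hq0 (hdown.trans_eq (by rw [hq]; ring)))
      (hmono (hnn _) hq0 hup))
  have hfin := apply_le_apply_zero_of_rankOneConvex hW hq0 hqlt hle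
  have hy : 0 ≤ 8 * Real.log B ^ 2 := by positivity
  exact le_antisymm ((hmono hx hy hxB).trans hfin) (hmono (Set.mem_Ici.2 le_rfl) hx hx)

/-- **Lemma 3.3.** Let `Ψ : [0,∞) → ℝ` be twice continuously differentiable and suppose that
`F ↦ Ψ(‖dev₃ log U‖²)` (with `U = √(FᵀF)`) is rank-one convex on `GL⁺(3)`. Then
(i) `Ψ` is convex on `[0,∞)`, and (ii) if `Ψ'(0) > 0` then `Ψ'(x) > 0` for all `x > 0`. -/
theorem convexity_and_strict_monotonicity_devLogU_dim3
    (Ψ : ℝ → ℝ) (hΨ : ContDiffOn ℝ 2 Ψ (Set.Ici 0))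
    (hW : RankOneConvex (fun F : Mat 3 => Ψ (nsq (dev (logU F))))) :
    ConvexOn ℝ (Set.Ici 0) Ψ ∧
    (0 < derivWithin Ψ (Set.Ici 0) 0 → ∀ x : ℝ, 0 < x → 0 < derivWithin Ψ (Set.Ici 0) x) := by
  have hconst : Set.EqOn Ψ (fun _ => Ψ 0) (Set.Ici 0) := fun x hx =>
    apply_eq_apply_zero_of_rankOneConvex hW hx
  refine ⟨(convexOn_const (Ψ 0) (convex_Ici 0)).congr hconst.symm, fun h0 => ?_⟩
  rw [derivWithin_congr hconst (hconst (Set.mem_Ici.2 le_rfl)), derivWithin_fun_const] at h0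
  exact absurd h0 (lt_irrefl 0)
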